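/- Let t₀ < t₁, let c₀ > 0, let y : [t₀, t₁] → ℝ be continuously differentiable, and let A, B : [t₀, t₁] → ℝ be continuous and nonnegative. Suppose that for all t ∈ [t₀, t₁], y(t)³·y'(t) + c₀·y(t)⁴ ≤ (A(t) + B(t))·|y(t)|³. Then there is a constant C depending only on c₀ such that y(t₁)⁴ − y(t₀)⁴ ≤ C·∫_{t₀}^{t₁} ( A(t)⁴ + B(t)⁴ ) dt; in particular one may take C = 2·(27/(4c₀))³. -/

import Mathlib

/-- Young's inequality with exponents `4/3` and `4`: the cubic term is absorbed by the quartic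
one. -/
theorem four_mul_mul_pow_three_sub_le {c z s : ℝ} (hc : 0 < c) :
    4 * (s * z ^ 3 - c * z ^ 4) ≤ 27 / (64 * c ^ 3) * s ^ 4 := by
  have hq : 0 ≤ (c * z - 3 * s / 4) ^ 2 *
      (3 * (c * z) ^ 2 + (c * z + s) ^ 2 - s ^ 2 / 4) := by
    apply mul_nonneg (sq_nonneg _)
    nlinarith [sq_nonneg (4 * (c * z) + s), sq_nonneg s]
  rw [div_mul_eq_mul_div, le_div_iff₀ (by positivity)]
  nlinarith [hq]

theorem add_pow_four_le (a b : ℝ) : (a + b) ^ 4 ≤ 8 * (a ^ 4 + b ^ 4) := by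
  nlinarith [mul_nonneg (sq_nonneg (a - b)) (sq_nonneg (a + b)),
    mul_nonneg (sq_nonneg (a - b)) (sq_nonneg a),
    mul_nonneg (sq_nonneg (a - b)) (sq_nonneg b), sq_nonneg (a ^ 2 - b ^ 2)]

/-- The ODE inequality behind the large-time pointwise density bound: if
y³y' + c₀y⁴ ≤ (A + B)|y|³ on [t₀, t₁] with A, B ≥ 0, then
y(t₁)⁴ − y(t₀)⁴ ≤ C ∫_{t₀}^{t₁} (A⁴ + B⁴), with C = 2(27/(4c₀))³. -/
theorem stmt14 (t₀ t₁ c₀ : ℝ) (ht : t₀ < t₁) (hc : 0 < c₀)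
    (y y' A B : ℝ → ℝ)
    (hy : ∀ t ∈ Set.Icc t₀ t₁, HasDerivAt y (y' t) t)
    (hy' : ContinuousOn y' (Set.Icc t₀ t₁))
    (hA : ContinuousOn A (Set.Icc t₀ t₁)) (hB : ContinuousOn B (Set.Icc t₀ t₁))
    (hA0 : ∀ t ∈ Set.Icc t₀ t₁, 0 ≤ A t) (hB0 : ∀ t ∈ Set.Icc t₀ t₁, 0 ≤ B t)
    (hineq : ∀ t ∈ Set.Icc t₀ t₁,
      y t ^ 3 * y' t + c₀ * y t ^ 4 ≤ (A t + B t) * |y t| ^ 3) :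
    y t₁ ^ 4 - y t₀ ^ 4
      ≤ 2 * (27 / (4 * c₀)) ^ 3 * ∫ t in t₀..t₁, (A t ^ 4 + B t ^ 4) := by
  have hu : Set.uIcc t₀ t₁ = Set.Icc t₀ t₁ := Set.uIcc_of_le ht.le
  have hyc : ContinuousOn y (Set.Icc t₀ t₁) :=
    fun t h => (hy t h).continuousAt.continuousWithinAt
  have hderiv : ∀ t ∈ Set.uIcc t₀ t₁,
      HasDerivAt (fun t => y t ^ 4) (4 * (y t ^ 3 * y' t)) t := by
    intro t h
    refine ((hy t (hu ▸ h)).pow 4).congr_deriv ?_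
    push_cast
    ring
  have hint : IntervalIntegrable (fun t => 4 * (y t ^ 3 * y' t)) MeasureTheory.volume t₀ t₁ := by
    apply ContinuousOn.intervalIntegrable
    rw [hu]
    fun_prop
  have hint' : IntervalIntegrable
      (fun t => 2 * (27 / (4 * c₀)) ^ 3 * (A t ^ 4 + B t ^ 4)) MeasureTheory.volume t₀ t₁ := by
    apply ContinuousOn.intervalIntegrable
    rw [hu]
    fun_prop
  rw [← intervalIntegral.integral_eq_sub_of_hasDerivAt hderiv hint,
    ← intervalIntegral.integral_const_mul]
  refine intervalIntegral.integral_mono_on ht.le hint hint' fun t h => ?_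
  have hyoung := four_mul_mul_pow_three_sub_le (z := |y t|) (s := A t + B t) hc
  have habs : |y t| ^ 4 = y t ^ 4 := Even.pow_abs (by decide) _
  rw [habs] at hyoung
  calc 4 * (y t ^ 3 * y' t) ≤ 27 / (64 * c₀ ^ 3) * (A t + B t) ^ 4 := by
        linarith [hineq t h]
    _ ≤ 27 / (64 * c₀ ^ 3) * (8 * (A t ^ 4 + B t ^ 4)) := by
        gcongr
        exact add_pow_four_le _ _
    _ = 27 / (8 * c₀ ^ 3) * (A t ^ 4 + B t ^ 4) := by
        field_simp
        norm_num
    _ ≤ 2 * (27 / (4 * c₀)) ^ 3 * (A t ^ 4 + B t ^ 4) := by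
        gcongr
        rw [div_pow, mul_pow, ← mul_div_assoc, div_le_div_iff₀ (by positivity) (by positivity)]
        nlinarith [pow_pos hc 3]
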